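/- Let ε, Δ > 0, n,m ∈ ℕ, γ ∈ [0,1/2), and let f ∈ F*_ε. Then for all d_A, d_B ∈ ℕ and every unit vector ψ ∈ (ℂ²)^{⊗m} ⊗ ℂ^{d_A} ⊗ ℂ^{d_B}, the number of z ∈ {0,1}^m such that ψ is Δ-good to attack z is at most (λ_γ/(λ_γ+Δ))^m · 2^m. -/

import Mathlib

open Matrix Kronecker Finset
open scoped ComplexOrder

noncomputable section

/-- Bit strings of length `n`. -/
abbrev Bits (n : ℕ) := Fin n → Bool

/-- Binary entropy function `h(p) = -p log₂ p - (1-p) log₂ (1-p)` (with `h 0 = 0`). -/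
def binEnt (p : ℝ) : ℝ := -(p * Real.logb 2 p) - (1 - p) * Real.logb 2 (1 - p)

/-- `λ_γ = 2^{h(γ)} (1/2 + 1/(2√2))`. -/
def lamGamma (γ : ℝ) : ℝ := (2 : ℝ) ^ binEnt γ * (1 / 2 + 1 / (2 * Real.sqrt 2))

/-- Standard basis vector `|a⟩` of `ℂ²`. -/
def ket (a : Bool) : Bool → ℂ := fun j => if j = a then 1 else 0

/-- The vector `H^z |a⟩` of `ℂ²`, where `H` is the 2×2 Hadamard matrix. -/
def hadVec (z a : Bool) : Bool → ℂ :=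
  if z then fun j => (if j && a then (-1 : ℂ) else 1) / (Real.sqrt 2 : ℂ) else ket a

/-- The unit vector `⊗_{i} H^{z_i}|a_i⟩` of `(ℂ²)^{⊗ m}`. -/
def bb84Vec {m : ℕ} (z a : Bits m) : Bits m → ℂ := fun j => ∏ i, hadVec (z i) (a i) (j i)

/-- `M^z_a`: the rank-one orthogonal projector onto `⊗_i H^{z_i}|a_i⟩`. -/
def Mproj {m : ℕ} (z a : Bits m) : Matrix (Bits m) (Bits m) ℂ :=
  vecMulVec (bb84Vec z a) (star (bb84Vec z a))

/-- A POVM: a family of positive semidefinite matrices summing to the identity. -/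
def IsPOVM {d : Type*} [Fintype d] [DecidableEq d] {ι : Type*} [Fintype ι]
    (A : ι → Matrix d d ℂ) : Prop :=
  (∀ a, (A a).PosSemidef) ∧ ∑ a, A a = 1


/-- `q_f(z)`: the fraction of input pairs `(x,y)` mapped by `f` to `z`. -/
def qf (n m : ℕ) (f : Bits n × Bits n → Bits m) (z : Bits m) : ℝ :=
  ((Finset.univ.filter (fun p : Bits n × Bits n => f p = z)).card : ℝ) / 2 ^ (2 * n)

/-- A state `ψ` is `Δ`-good to attack `z`: there exist POVMs achieving acceptance
probability at least `(λ_γ+Δ)^m (1 + 3 √(3 ln(2/ε)) 2^{-n+m/2})` on input `z`. -/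
def DeltaGood (n m dA dB : ℕ) (γ ε Δ : ℝ) (ψ : Bits m × Fin dA × Fin dB → ℂ)
    (z : Bits m) : Prop :=
  ∃ (A : Bits m → Matrix (Fin dA) (Fin dA) ℂ) (B : Bits m → Matrix (Fin dB) (Fin dB) ℂ),
    IsPOVM A ∧ IsPOVM B ∧
    (lamGamma γ + Δ) ^ m *
        (1 + 3 * Real.sqrt (3 * Real.log (2 / ε)) * (2 : ℝ) ^ (-(n : ℝ) + m / 2)) ≤
      ∑ a : Bits m,
        (star ψ ⬝ᵥ ((Mproj z a ⊗ₖ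
            (∑ a' ∈ Finset.univ.filter
                (fun a' : Bits m => (hammingDist a a' : ℝ) ≤ γ * m),
              A a' ⊗ₖ B a')).mulVec ψ)).re

section Operators

variable {K : Type*} [NormedAddCommGroup K] [InnerProductSpace ℂ K]

theorem norm_inner_le_half_sq_add_sq {p q : K} :
    ‖inner ℂ p q‖ ≤ (‖p‖ ^ 2 + ‖q‖ ^ 2) / 2 := by
  nlinarith [norm_inner_le_norm (𝕜 := ℂ) p q, sq_nonneg (‖p‖ - ‖q‖)]

variable [CompleteSpace K]

theorem inner_selfAdjoint_left {T : K →L[ℂ] K} (hT : IsSelfAdjoint T) (u v : K) :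
    inner ℂ (T u) v = inner ℂ u (T v) := by
  rw [← ContinuousLinearMap.adjoint_inner_right, hT.adjoint_eq]

theorem sum_norm_sq_apply {α : Type*} [Fintype α] {X : α → K →L[ℂ] K}
    (hX : ∀ a, IsSelfAdjoint (X a)) (hsum : ∑ a, X a * X a = 1) (u : K) :
    ∑ a, ‖X a u‖ ^ 2 = ‖u‖ ^ 2 := by
  have h : ∑ a, inner ℂ (X a u) (X a u) = inner ℂ u u := by
    simp_rw [inner_selfAdjoint_left (hX _), ← inner_sum]
    congr 1
    simpa using congrArg (fun T : K →L[ℂ] K => T u) hsum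
  simp_rw [inner_self_eq_norm_sq_to_K] at h
  exact_mod_cast h

theorem norm_sq_apply_le {α : Type*} [Fintype α] {X : α → K →L[ℂ] K}
    (hX : ∀ a, IsSelfAdjoint (X a)) (hsum : ∑ a, X a * X a = 1) (a : α) (u : K) :
    ‖X a u‖ ^ 2 ≤ ‖u‖ ^ 2 := by
  rw [← sum_norm_sq_apply hX hsum u]
  exact Finset.single_le_sum (f := fun a => ‖X a u‖ ^ 2) (fun _ _ => by positivity)
    (Finset.mem_univ a)

theorem sum_norm_inner_le {α : Type*} [Fintype α] {X Y X' Y' : α → K →L[ℂ] K}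
    (hX : ∀ a, IsSelfAdjoint (X a)) (hXsum : ∑ a, X a * X a = 1)
    (hY : ∀ a, IsSelfAdjoint (Y a)) (hYsum : ∑ a, Y a * Y a = 1)
    (hX' : ∀ a, IsSelfAdjoint (X' a)) (hXsum' : ∑ a, X' a * X' a = 1)
    (hY' : ∀ a, IsSelfAdjoint (Y' a)) (hYsum' : ∑ a, Y' a * Y' a = 1)
    (hXY : ∀ a a', Commute (X a) (Y a')) (hXY' : ∀ a a', Commute (X a) (Y' a'))
    (u v : α → K) :
    ∑ a, ∑ a', ‖inner ℂ (Y a (X a (u a))) (Y' a' (X' a' (v a')))‖ ≤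
      (∑ a, ‖u a‖ ^ 2 + ∑ a, ‖v a‖ ^ 2) / 2 := by
  have key : ∀ a a', inner ℂ (Y a (X a (u a))) (Y' a' (X' a' (v a'))) =
      inner ℂ (Y' a' (Y a (u a))) (X a (X' a' (v a'))) := by
    intro a a'
    have h1 : Y a (X a (u a)) = X a (Y a (u a)) :=
      (DFunLike.congr_fun (hXY a a).eq (u a)).symm
    have h2 : X a (Y' a' (X' a' (v a'))) = Y' a' (X a (X' a' (v a'))) :=
      DFunLike.congr_fun (hXY' a a').eq (X' a' (v a'))
    rw [h1, inner_selfAdjoint_left (hX a), h2, inner_selfAdjoint_left (hY' a')]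
  calc ∑ a, ∑ a', ‖inner ℂ (Y a (X a (u a))) (Y' a' (X' a' (v a')))‖
      ≤ ∑ a, ∑ a', (‖Y' a' (Y a (u a))‖ ^ 2 + ‖X a (X' a' (v a'))‖ ^ 2) / 2 := by
        gcongr with a _ a' _
        rw [key]
        exact norm_inner_le_half_sq_add_sq
    _ = (∑ a, ‖Y a (u a)‖ ^ 2 + ∑ a', ‖X' a' (v a')‖ ^ 2) / 2 := by
        simp_rw [← Finset.sum_div, Finset.sum_add_distrib]
        rw [Finset.sum_comm (f := fun a a' => ‖X a (X' a' (v a'))‖ ^ 2)]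
        simp_rw [sum_norm_sq_apply hY' hYsum', sum_norm_sq_apply hX hXsum]
    _ ≤ _ := by
        have hu := Finset.sum_le_sum fun a (_ : a ∈ Finset.univ) =>
          norm_sq_apply_le hY hYsum a (u a)
        have hv := Finset.sum_le_sum fun a (_ : a ∈ Finset.univ) =>
          norm_sq_apply_le hX' hXsum' a (v a)
        linarith

/-- Monogamy bound: the winning amplitudes of two commuting families of measurements, summed over
all questions, are controlled by the overlaps of the measurement vectors. -/
theorem sum_norm_sq_le_of_overlap {ζ α χ : Type*} [Fintype ζ] [Fintype α] [Fintype χ]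
    {X Y : ζ → α → K →L[ℂ] K}
    (hX : ∀ z a, IsSelfAdjoint (X z a)) (hXsum : ∀ z, ∑ a, X z a * X z a = 1)
    (hY : ∀ z a, IsSelfAdjoint (Y z a)) (hYsum : ∀ z, ∑ a, Y z a * Y z a = 1)
    (hXY : ∀ z a z' a', Commute (X z a) (Y z' a'))
    (φ : ζ → α → χ → ℂ) (κ : ζ → ζ → ℝ) (hκ : ∀ z z', κ z z' = κ z' z)
    (hφ : ∀ z a z' a', ‖∑ x, star (φ z a x) * φ z' a' x‖ ≤ κ z z')
    {C : ℝ} (hC : 0 < C) (hκC : ∀ z, ∑ z', κ z z' ≤ C)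
    (ψ : χ → K) (hψ : ∑ x, ‖ψ x‖ ^ 2 = 1) :
    ∑ z, ∑ a, ‖X z a (Y z a (∑ x, star (φ z a x) • ψ x))‖ ^ 2 ≤ C := by
  by_cases hα : Nonempty α
  swap
  · have := not_nonempty_iff.mp hα
    simpa using hC.le
  obtain ⟨a₀⟩ := hα
  have hκ0 : ∀ z z', 0 ≤ κ z z' := fun z z' => (norm_nonneg _).trans (hφ z a₀ z' a₀)
  set u : ζ → α → K := fun z a => X z a (Y z a (∑ x, star (φ z a x) • ψ x)) with hu
  set w : χ → K := fun x => ∑ z, ∑ a, φ z a x • Y z a (X z a (u z a)) with hw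
  set S : ℝ := ∑ z, ∑ a, ‖u z a‖ ^ 2 with hS
  have hSinner : (S : ℂ) = ∑ x, inner ℂ (ψ x) (w x) := by
    have h1 : ∀ z a, ((‖u z a‖ ^ 2 : ℝ) : ℂ) =
        ∑ x, φ z a x * inner ℂ (ψ x) (Y z a (X z a (u z a))) := by
      intro z a
      have : ((‖u z a‖ ^ 2 : ℝ) : ℂ) = inner ℂ (u z a) (u z a) := by
        rw [inner_self_eq_norm_sq_to_K]; push_cast; rfl
      rw [this]
      nth_rewrite 1 [hu]
      simp only
      rw [inner_selfAdjoint_left (hX z a), inner_selfAdjoint_left (hY z a), sum_inner]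
      simp [inner_smul_left]
    rw [hS]
    push_cast
    simp_rw [hw, inner_sum, inner_smul_right]
    symm
    rw [Finset.sum_comm]
    refine Finset.sum_congr rfl fun z _ => ?_
    rw [Finset.sum_comm]
    refine Finset.sum_congr rfl fun a _ => ?_
    exact_mod_cast (h1 z a).symm
  have hwS : ∑ x, ‖w x‖ ^ 2 ≤ C * S := by
    have h1 : ((∑ x, ‖w x‖ ^ 2 : ℝ) : ℂ) = ∑ z, ∑ z', ∑ a, ∑ a',
        (∑ x, star (φ z a x) * φ z' a' x) *
          inner ℂ (Y z a (X z a (u z a))) (Y z' a' (X z' a' (u z' a'))) := by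
      push_cast
      have h2 : ∀ x, ((‖w x‖ : ℂ)) ^ 2 = ∑ z, ∑ z', ∑ a, ∑ a',
          (star (φ z a x) * φ z' a' x) *
          inner ℂ (Y z a (X z a (u z a))) (Y z' a' (X z' a' (u z' a'))) := by
        intro x
        have : ((‖w x‖ : ℂ)) ^ 2 = inner ℂ (w x) (w x) := by
          rw [inner_self_eq_norm_sq_to_K]; rfl
        rw [this, hw]
        simp only
        rw [sum_inner]
        refine Finset.sum_congr rfl fun z _ => ?_
        rw [inner_sum]
        refine Finset.sum_congr rfl fun z' _ => ?_
        rw [sum_inner]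
        refine Finset.sum_congr rfl fun a _ => ?_
        rw [inner_sum]
        refine Finset.sum_congr rfl fun a' _ => ?_
        rw [inner_smul_left, inner_smul_right, mul_assoc]
        rfl
      simp_rw [h2, Finset.sum_mul]
      rw [Finset.sum_comm]
      refine Finset.sum_congr rfl fun z _ => ?_
      rw [Finset.sum_comm]
      refine Finset.sum_congr rfl fun z' _ => ?_
      rw [Finset.sum_comm]
      refine Finset.sum_congr rfl fun a _ => ?_
      rw [Finset.sum_comm]
    have h3 : ∑ x, ‖w x‖ ^ 2 = ‖((∑ x, ‖w x‖ ^ 2 : ℝ) : ℂ)‖ := by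
      rw [Complex.norm_real, Real.norm_of_nonneg]
      positivity
    rw [h3, h1]
    calc _ ≤ ∑ z, ∑ z', κ z z' * ((∑ a, ‖u z a‖ ^ 2 + ∑ a, ‖u z' a‖ ^ 2) / 2) := by
          refine (norm_sum_le _ _).trans (Finset.sum_le_sum fun z _ => ?_)
          refine (norm_sum_le _ _).trans (Finset.sum_le_sum fun z' _ => ?_)
          refine le_trans ?_ (mul_le_mul_of_nonneg_left
            (sum_norm_inner_le (hX z) (hXsum z) (hY z) (hYsum z) (hX z') (hXsum z') (hY z')
              (hYsum z') (fun a a' => hXY z a z a') (fun a a' => hXY z a z' a') (u z) (u z'))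
            (hκ0 z z'))
          rw [Finset.mul_sum]
          refine (norm_sum_le _ _).trans (Finset.sum_le_sum fun a _ => ?_)
          rw [Finset.mul_sum]
          refine (norm_sum_le _ _).trans (Finset.sum_le_sum fun a' _ => ?_)
          rw [norm_mul]
          exact mul_le_mul_of_nonneg_right (hφ z a z' a') (norm_nonneg _)
      _ = ∑ z, (∑ z', κ z z') * ∑ a, ‖u z a‖ ^ 2 := by
          have e1 : ∀ z z', κ z z' * ((∑ a, ‖u z a‖ ^ 2 + ∑ a, ‖u z' a‖ ^ 2) / 2) =
            κ z z' * (∑ a, ‖u z a‖ ^ 2) / 2 + κ z' z * (∑ a, ‖u z' a‖ ^ 2) / 2 := by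
            intro z z'
            rw [hκ z' z]
            ring
          simp_rw [e1, Finset.sum_add_distrib]
          rw [Finset.sum_comm (f := fun z z' => κ z' z * (∑ a, ‖u z' a‖ ^ 2) / 2),
            ← Finset.sum_add_distrib]
          refine Finset.sum_congr rfl fun z _ => ?_
          rw [← Finset.sum_add_distrib, Finset.sum_mul]
          refine Finset.sum_congr rfl fun z' _ => ?_
          ring
      _ ≤ ∑ z, C * ∑ a, ‖u z a‖ ^ 2 := by
          gcongr with z _
          exact hκC z
      _ = C * S := by rw [← Finset.mul_sum]
  have hSle : S ≤ ∑ x, (C * ‖ψ x‖ ^ 2 + ‖w x‖ ^ 2 / C) / 2 := by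
    have h0 : S ≤ ‖(S : ℂ)‖ := by
      rw [Complex.norm_real]
      exact Real.le_norm_self S
    refine h0.trans ?_
    rw [hSinner]
    refine (norm_sum_le _ _).trans (Finset.sum_le_sum fun x _ => ?_)
    refine (norm_inner_le_norm _ _).trans ?_
    have : 0 ≤ (C * ‖ψ x‖ - ‖w x‖) ^ 2 / C := by positivity
    have h2 : (C * ‖ψ x‖ - ‖w x‖) ^ 2 / C =
        C * ‖ψ x‖ ^ 2 + ‖w x‖ ^ 2 / C - 2 * (‖ψ x‖ * ‖w x‖) := by
      field_simp
      ring
    linarith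
  rw [← Finset.sum_div, Finset.sum_add_distrib, ← Finset.mul_sum, ← Finset.sum_div, hψ] at hSle
  have : (∑ x, ‖w x‖ ^ 2) / C ≤ S := by
    rw [div_le_iff₀ hC]
    linarith
  linarith

end Operators

section Matrices

variable {d : Type*} [Fintype d]

theorem dotProduct_vecMulVec_kronecker {χ : Type*} [Fintype χ] (φ : χ → ℂ) (N : Matrix d d ℂ)
    (ψ : χ × d → ℂ) :
    star ψ ⬝ᵥ ((vecMulVec φ (star φ) ⊗ₖ N).mulVec ψ) =
      star (fun j => ∑ x, star (φ x) * ψ (x, j)) ⬝ᵥ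
        (N.mulVec fun j => ∑ x, star (φ x) * ψ (x, j)) := by
  simp only [dotProduct, mulVec, Fintype.sum_prod_type, kroneckerMap_apply, vecMulVec_apply,
    Pi.star_apply, star_sum, star_mul', star_star, Finset.mul_sum, Finset.sum_mul]
  rw [Finset.sum_comm]
  refine Finset.sum_congr rfl fun j _ => ?_
  refine (Finset.sum_congr rfl fun x _ => Finset.sum_comm).trans ?_
  rw [Finset.sum_comm]
  refine Finset.sum_congr rfl fun k _ => ?_
  rw [Finset.sum_comm]
  refine Finset.sum_congr rfl fun x _ => Finset.sum_congr rfl fun y _ => ?_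
  ring

variable [DecidableEq d]

theorem Matrix.PosSemidef.exists_isHermitian_mul_self {A : Matrix d d ℂ} (hA : A.PosSemidef) :
    ∃ R : Matrix d d ℂ, R.IsHermitian ∧ R * R = A := by
  open scoped MatrixOrder in
  exact ⟨CFC.sqrt A, (CFC.sqrt_nonneg A).posSemidef.isHermitian,
    CFC.sqrt_mul_sqrt_self A hA.nonneg⟩

theorem re_dotProduct_mul_self {R : Matrix d d ℂ} (v : d → ℂ) :
    (star v ⬝ᵥ ((Rᴴ * R).mulVec v)).re = ‖toEuclideanCLM (𝕜 := ℂ) R (WithLp.toLp 2 v)‖ ^ 2 := by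
  rw [← mulVec_mulVec, dotProduct_mulVec, ← star_mulVec, EuclideanSpace.norm_sq_eq]
  simp [dotProduct, Complex.conj_mul', ← Complex.ofReal_pow]

end Matrices

section Bits

theorem sum_bits_prod {m : ℕ} (g : Fin m → Bool → ℝ) :
    ∑ e : Bits m, ∏ i, g i (e i) = ∏ i, (g i true + g i false) := by
  simp_rw [← Fintype.sum_bool, Finset.prod_univ_sum, Fintype.piFinset_univ]

theorem norm_sum_hadVec_le (z a z' a' : Bool) :
    ‖∑ j, star (hadVec z a j) * hadVec z' a' j‖ ≤ if z = z' then 1 else 1 / Real.sqrt 2 := by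
  have h2 : (Real.sqrt 2 : ℂ) * (Real.sqrt 2 : ℂ) = 2 := by
    rw [← Complex.ofReal_mul, Real.mul_self_sqrt (by norm_num)]; norm_num
  have h3 : |Real.sqrt 2| = Real.sqrt 2 := abs_of_nonneg (Real.sqrt_nonneg 2)
  have h4 : (Real.sqrt 2)⁻¹ * (Real.sqrt 2)⁻¹ = 1 / 2 := by
    rw [← mul_inv, Real.mul_self_sqrt (by norm_num), one_div]
  cases z <;> cases a <;> cases z' <;> cases a' <;>
    simp [hadVec, ket, neg_div, div_mul_div_comm, h2, h3, h4]
  all_goals norm_num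

theorem norm_sum_bb84Vec_le {m : ℕ} (z a z' a' : Bits m) :
    ‖∑ x, star (bb84Vec z a x) * bb84Vec z' a' x‖ ≤
      ∏ i, if z i = z' i then 1 else 1 / Real.sqrt 2 := by
  have h : ∑ x, star (bb84Vec z a x) * bb84Vec z' a' x =
      ∏ i, ∑ j, star (hadVec (z i) (a i) j) * hadVec (z' i) (a' i) j := by
    simp_rw [bb84Vec, Finset.prod_univ_sum, Fintype.piFinset_univ, Finset.prod_mul_distrib,
      star_prod]
  rw [h, norm_prod]
  exact Finset.prod_le_prod (fun _ _ => norm_nonneg _) fun i _ => norm_sum_hadVec_le _ _ _ _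

theorem sum_overlap_bound {m : ℕ} (z : Bits m) :
    ∑ z' : Bits m, ∏ i, (if z i = z' i then 1 else 1 / Real.sqrt 2) =
      (1 + 1 / Real.sqrt 2) ^ m := by
  rw [sum_bits_prod fun i b => if z i = b then 1 else 1 / Real.sqrt 2]
  have : ∀ i, ((if z i = true then 1 else 1 / Real.sqrt 2) +
      if z i = false then 1 else 1 / Real.sqrt 2) = 1 + 1 / Real.sqrt 2 := by
    intro i
    cases z i <;> simp [add_comm]
  simp_rw [this, Finset.prod_const, Finset.card_univ, Fintype.card_fin]

/-- The Hamming ball of radius `γ m` has at most `2^{h(γ) m}` elements. -/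
theorem card_hammingBall_le {m : ℕ} {γ : ℝ} (hγ0 : 0 ≤ γ) (hγ1 : γ < 1 / 2) :
    ((Finset.univ.filter fun e : Bits m =>
        (hammingDist e (fun _ => false) : ℝ) ≤ γ * m).card : ℝ) ≤ ((2 : ℝ) ^ binEnt γ) ^ m := by
  rcases hγ0.eq_or_lt with rfl | hγ
  · have : (Finset.univ.filter fun e : Bits m =>
        (hammingDist e (fun _ => false) : ℝ) ≤ 0 * m) ⊆ {fun _ => false} := by
      intro e he
      simpa using he
    have := Finset.card_le_card this
    simp only [Finset.card_singleton] at this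
    simpa [binEnt] using this
  have hγ' : 0 < 1 - γ := by linarith
  have hbase : ((2 : ℝ) ^ binEnt γ)⁻¹ = γ ^ γ * (1 - γ) ^ (1 - γ) := by
    rw [← Real.rpow_neg (by norm_num), binEnt, neg_sub, sub_neg_eq_add, add_comm,
      Real.rpow_add (by norm_num), mul_comm γ, mul_comm (1 - γ), Real.rpow_mul (by norm_num),
      Real.rpow_mul (by norm_num), Real.rpow_logb (by norm_num) (by norm_num) hγ,
      Real.rpow_logb (by norm_num) (by norm_num) hγ']
  have hsum : ∑ e : Bits m, ∏ i, (if e i then γ else 1 - γ) = 1 := by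
    rw [sum_bits_prod fun _ b => if b then γ else 1 - γ]
    simp
  have hterm : ∀ e : Bits m, (hammingDist e (fun _ => false) : ℝ) ≤ γ * m →
      (((2 : ℝ) ^ binEnt γ) ^ m)⁻¹ ≤ ∏ i, (if e i then γ else 1 - γ) := by
    intro e he
    set k := hammingDist e (fun _ => false) with hk
    have hkm : k ≤ m := by simpa using hammingDist_le_card_fintype (x := e) (y := fun _ => false)
    have hprod : ∏ i, (if e i then γ else 1 - γ) = γ ^ k * (1 - γ) ^ (m - k) := by
      have h1 : (Finset.univ.filter fun i => e i = true).card = k := by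
        simp [hk, hammingDist]
      have h2 : (Finset.univ.filter fun i => ¬ e i = true).card = m - k := by
        rw [← h1]
        have := Finset.card_filter_add_card_filter_not (s := Finset.univ) (fun i => e i = true)
        simp only [Finset.card_univ, Fintype.card_fin] at this
        omega
      rw [Finset.prod_ite, Finset.prod_const, Finset.prod_const, h1, h2]
    rw [hprod, ← inv_pow, hbase, mul_pow, ← Real.rpow_natCast, ← Real.rpow_natCast,
      ← Real.rpow_mul hγ0, ← Real.rpow_mul hγ'.le, ← Real.rpow_natCast, ← Real.rpow_natCast,
      Nat.cast_sub hkm]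
    have e1 : γ ^ (k : ℝ) * (1 - γ) ^ ((m : ℝ) - k) =
        γ ^ (γ * m) * (1 - γ) ^ ((1 - γ) * m) * ((1 - γ) / γ) ^ (γ * m - k) := by
      rw [Real.div_rpow hγ'.le hγ0, Real.rpow_sub hγ, Real.rpow_sub hγ',
        Real.rpow_sub hγ', one_sub_mul, Real.rpow_sub hγ']
      field_simp
    rw [e1]
    refine le_mul_of_one_le_right (by positivity) (Real.one_le_rpow ?_ (by linarith))
    rw [le_div_iff₀ hγ]
    linarith
  have hpos : 0 < ((2 : ℝ) ^ binEnt γ) ^ m := by positivity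
  have : (Finset.univ.filter fun e : Bits m =>
      (hammingDist e (fun _ => false) : ℝ) ≤ γ * m).card • (((2 : ℝ) ^ binEnt γ) ^ m)⁻¹ ≤ 1 := by
    rw [← hsum]
    refine (Finset.card_nsmul_le_sum _ (fun e : Bits m => ∏ i, (if e i then γ else 1 - γ)) _
      fun e he => hterm e (Finset.mem_filter.mp he).2).trans ?_
    refine Finset.sum_le_sum_of_subset_of_nonneg (Finset.subset_univ _) fun e _ _ => ?_
    exact Finset.prod_nonneg fun i _ => by split_ifs <;> linarith
  rw [nsmul_eq_mul, ← div_eq_mul_inv, div_le_one hpos] at this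
  exact this

/-- Translation of bit strings by `c`. -/
def xorEquiv {m : ℕ} (c : Bits m) : Bits m ≃ Bits m where
  toFun e := fun i => xor (e i) (c i)
  invFun e := fun i => xor (e i) (c i)
  left_inv e := by funext i; simp
  right_inv e := by funext i; simp

theorem hammingDist_xorEquiv {m : ℕ} (e c : Bits m) :
    hammingDist (xorEquiv c e) c = hammingDist e (fun _ => false) := by
  refine congrArg Finset.card (Finset.filter_congr fun i _ => ?_)
  simp only [xorEquiv, Equiv.coe_fn_mk]
  cases e i <;> cases c i <;> simp

theorem sum_sum_hammingBall {m : ℕ} (r : ℝ) (F : Bits m → Bits m → ℝ) :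
    ∑ a, ∑ a' ∈ Finset.univ.filter (fun a' : Bits m => (hammingDist a a' : ℝ) ≤ r), F a a' =
      ∑ e ∈ Finset.univ.filter (fun e : Bits m => (hammingDist e (fun _ => false) : ℝ) ≤ r),
        ∑ a', F (xorEquiv e a') a' := by
  have hswap : ∀ e a' : Bits m, xorEquiv e a' = xorEquiv a' e := by
    intro e a'
    funext i
    simp [xorEquiv, Bool.xor_comm]
  simp_rw [Finset.sum_filter]
  rw [Finset.sum_comm]
  have h : ∀ a' : Bits m, ∑ a, (if (hammingDist a a' : ℝ) ≤ r then F a a' else 0) =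
      ∑ e, if (hammingDist e (fun _ => false) : ℝ) ≤ r then F (xorEquiv e a') a' else 0 := by
    intro a'
    rw [← (xorEquiv a').sum_comp]
    simp_rw [hammingDist_xorEquiv, hswap]
  simp_rw [h]
  rw [Finset.sum_comm]
  refine Finset.sum_congr rfl fun e _ => ?_
  split_ifs <;> simp

end Bits

/-- Probability that both attackers output `a'` with `d_H(a, a') ≤ γ m`, where `a` is the outcome of
measuring in the basis `z`. -/
def winProb {m : ℕ} {dA dB : Type*} [Fintype dA] [Fintype dB] (γ : ℝ)
    (A : Bits m → Matrix dA dA ℂ) (B : Bits m → Matrix dB dB ℂ)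
    (ψ : Bits m × dA × dB → ℂ) (z : Bits m) : ℝ :=
  ∑ a : Bits m,
    (star ψ ⬝ᵥ ((Mproj z a ⊗ₖ
        (∑ a' ∈ Finset.univ.filter (fun a' : Bits m => (hammingDist a a' : ℝ) ≤ γ * m),
          A a' ⊗ₖ B a')).mulVec ψ)).re

section Game

variable {m : ℕ} {dA dB : Type*} [Fintype dA] [Fintype dB]

theorem winProb_eq (γ : ℝ) (A : Bits m → Matrix dA dA ℂ) (B : Bits m → Matrix dB dB ℂ)
    (ψ : Bits m × dA × dB → ℂ) (z : Bits m) :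
    winProb γ A B ψ z =
      ∑ e ∈ Finset.univ.filter
          (fun e : Bits m => (hammingDist e (fun _ => false) : ℝ) ≤ γ * m),
        ∑ a', (star ψ ⬝ᵥ
          ((Mproj z (xorEquiv e a') ⊗ₖ (A a' ⊗ₖ B a')).mulVec ψ)).re := by
  rw [← sum_sum_hammingBall (γ * m)
    fun a a' => (star ψ ⬝ᵥ ((Mproj z a ⊗ₖ (A a' ⊗ₖ B a')).mulVec ψ)).re]
  refine Finset.sum_congr rfl fun a _ => ?_
  have h : ∀ (M : Matrix (Bits m) (Bits m) ℂ) (s : Finset (Bits m)),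
      M ⊗ₖ (∑ a' ∈ s, A a' ⊗ₖ B a') = ∑ a' ∈ s, M ⊗ₖ (A a' ⊗ₖ B a') := by
    intro M s
    ext i j
    simp [kroneckerMap_apply, Matrix.sum_apply, Finset.mul_sum]
  rw [h, sum_mulVec, dotProduct_sum, Complex.re_sum]

variable [DecidableEq dA] [DecidableEq dB]

theorem sum_sum_win_le (A : Bits m → Bits m → Matrix dA dA ℂ) (B : Bits m → Bits m → Matrix dB dB ℂ)
    (hA : ∀ z, IsPOVM (A z)) (hB : ∀ z, IsPOVM (B z))
    (ψ : Bits m × dA × dB → ℂ) (hψ : ∑ i, ‖ψ i‖ ^ 2 = 1) (e : Bits m) :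
    ∑ z, ∑ a', (star ψ ⬝ᵥ
      ((Mproj z (xorEquiv e a') ⊗ₖ (A z a' ⊗ₖ B z a')).mulVec ψ)).re ≤
        (1 + 1 / Real.sqrt 2) ^ m := by
  choose α hαh hα using fun z a => ((hA z).1 a).exists_isHermitian_mul_self
  choose β hβh hβ using fun z a => ((hB z).1 a).exists_isHermitian_mul_self
  let T := toEuclideanCLM (n := dA × dB) (𝕜 := ℂ)
  have hXh : ∀ z a, (α z a ⊗ₖ (1 : Matrix dB dB ℂ)).IsHermitian := by
    intro z a
    rw [IsHermitian, conjTranspose_kronecker, (hαh z a).eq, conjTranspose_one]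
  have hYh : ∀ z a, ((1 : Matrix dA dA ℂ) ⊗ₖ β z a).IsHermitian := by
    intro z a
    rw [IsHermitian, conjTranspose_kronecker, (hβh z a).eq, conjTranspose_one]
  have hXY : ∀ z a z' a', Commute (α z a ⊗ₖ (1 : Matrix dB dB ℂ))
      ((1 : Matrix dA dA ℂ) ⊗ₖ β z' a') := by
    intro z a z' a'
    rw [Commute, SemiconjBy, ← mul_kronecker_mul, ← mul_kronecker_mul]
    simp
  have key := sum_norm_sq_le_of_overlap
    (X := fun z a => T (α z a ⊗ₖ 1)) (Y := fun z a => T (1 ⊗ₖ β z a))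
    (fun z a => (hXh z a).isSelfAdjoint.map T)
    (fun z => by
      simp_rw [← map_mul, ← map_sum, ← mul_kronecker_mul, hα]
      rw [← map_one T, ← one_kronecker_one, ← (hA z).2]
      congr 1
      ext i j
      simp [kroneckerMap_apply, Matrix.sum_apply, Finset.sum_mul])
    (fun z a => (hYh z a).isSelfAdjoint.map T)
    (fun z => by
      simp_rw [← map_mul, ← map_sum, ← mul_kronecker_mul, hβ]
      rw [← map_one T, ← one_kronecker_one, ← (hB z).2]
      congr 1
      ext i j
      simp [kroneckerMap_apply, Matrix.sum_apply, Finset.mul_sum])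
    (fun z a z' a' => (hXY z a z' a').map T)
    (fun z a' => bb84Vec z (xorEquiv e a'))
    (fun z z' : Bits m => ∏ i, if z i = z' i then 1 else 1 / Real.sqrt 2)
    (fun z z' => by simp_rw [eq_comm])
    (fun z a z' a' => norm_sum_bb84Vec_le _ _ _ _)
    (C := (1 + 1 / Real.sqrt 2) ^ m) (by positivity)
    (fun z => (sum_overlap_bound z).le)
    (fun x => WithLp.toLp 2 fun j => ψ (x, j))
    (by simpa [EuclideanSpace.norm_sq_eq, Fintype.sum_prod_type] using hψ)
  refine le_of_eq_of_le (Finset.sum_congr rfl fun z _ => Finset.sum_congr rfl fun a _ => ?_) key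
  have hfac : A z a ⊗ₖ B z a = ((α z a ⊗ₖ (1 : Matrix dB dB ℂ)) * ((1 : Matrix dA dA ℂ) ⊗ₖ β z a))ᴴ *
      ((α z a ⊗ₖ (1 : Matrix dB dB ℂ)) * ((1 : Matrix dA dA ℂ) ⊗ₖ β z a)) := by
    rw [← mul_kronecker_mul, conjTranspose_kronecker, ← mul_kronecker_mul]
    simp [(hαh z a).eq, (hβh z a).eq, hα, hβ]
  have hv : (WithLp.toLp 2 fun j => ∑ x, star (bb84Vec z (xorEquiv e a) x) * ψ (x, j)) =
      ∑ x, star (bb84Vec z (xorEquiv e a) x) • WithLp.toLp 2 fun j => ψ (x, j) := by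
    ext j
    simp
  rw [Mproj, dotProduct_vecMulVec_kronecker, hfac, re_dotProduct_mul_self, map_mul,
    mul_apply_eq_comp, hv]

theorem sum_winProb_le {γ : ℝ} (hγ0 : 0 ≤ γ) (hγ1 : γ < 1 / 2)
    (A : Bits m → Bits m → Matrix dA dA ℂ) (B : Bits m → Bits m → Matrix dB dB ℂ)
    (hA : ∀ z, IsPOVM (A z)) (hB : ∀ z, IsPOVM (B z))
    (ψ : Bits m × dA × dB → ℂ) (hψ : ∑ i, ‖ψ i‖ ^ 2 = 1) :
    ∑ z, winProb γ (A z) (B z) ψ z ≤ lamGamma γ ^ m * 2 ^ m := by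
  simp_rw [winProb_eq]
  rw [Finset.sum_comm]
  refine (Finset.sum_le_card_nsmul _ _ _ fun e _ => sum_sum_win_le A B hA hB ψ hψ e).trans ?_
  rw [nsmul_eq_mul, lamGamma, mul_pow, mul_assoc, ← mul_pow]
  have : (1 / 2 + 1 / (2 * Real.sqrt 2)) * 2 = 1 + 1 / Real.sqrt 2 := by
    field_simp
  rw [this]
  gcongr
  exact card_hammingBall_le hγ0 hγ1

theorem winProb_nonneg (γ : ℝ) {A : Bits m → Matrix dA dA ℂ} {B : Bits m → Matrix dB dB ℂ}
    (hA : IsPOVM A) (hB : IsPOVM B) (ψ : Bits m × dA × dB → ℂ) (z : Bits m) :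
    0 ≤ winProb γ A B ψ z := by
  refine Finset.sum_nonneg fun a _ => ?_
  refine PosSemidef.re_dotProduct_nonneg (𝕜 := ℂ) (PosSemidef.kronecker ?_ ?_) ψ
  · exact posSemidef_vecMulVec_self_star _
  · exact posSemidef_sum _ fun a' _ => (hA.1 a').kronecker (hB.1 a')

theorem exists_isPOVM (d : Type*) [Fintype d] [DecidableEq d] :
    ∃ A : Bits m → Matrix d d ℂ, IsPOVM A := by
  refine ⟨Pi.single (fun _ => false) 1, fun a => ?_, by simp⟩
  by_cases h : a = fun _ => false
  · subst h
    simpa using PosSemidef.one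
  · simpa [Pi.single_apply, h] using PosSemidef.zero

end Game

/-- for `f ∈ F*_ε`, any state is `Δ`-good for at most a fraction
`(λ_γ/(λ_γ+Δ))^m` of all `z ∈ {0,1}^m`. -/
theorem stmt3 (ε Δ : ℝ) (hε : 0 < ε) (hΔ : 0 < Δ) (n m : ℕ)
    (γ : ℝ) (hγ0 : 0 ≤ γ) (hγ1 : γ < 1 / 2)
    (f : Bits n × Bits n → Bits m)
    (hf : ∀ z : Bits m,
      |qf n m f z - (2 : ℝ) ^ (-(m : ℝ))| ≤
        Real.sqrt (3 * Real.log (2 / ε)) * (2 : ℝ) ^ (-(n : ℝ) - m / 2))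
    (hregime : Real.sqrt (3 * Real.log (2 / ε)) * (2 : ℝ) ^ (-(n : ℝ) + m / 2) < 1 / 4)
    (dA dB : ℕ)
    (ψ : Bits m × Fin dA × Fin dB → ℂ) (hψ : ∑ i, ‖ψ i‖ ^ 2 = 1) :
    (({z : Bits m | DeltaGood n m dA dB γ ε Δ ψ z}.ncard : ℝ)) ≤
      (lamGamma γ / (lamGamma γ + Δ)) ^ m * 2 ^ m := by
  classical
  set G : Set (Bits m) := {z | DeltaGood n m dA dB γ ε Δ ψ z} with hG
  have hex : ∀ z : Bits m, ∃ (A : Bits m → Matrix (Fin dA) (Fin dA) ℂ)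
      (B : Bits m → Matrix (Fin dB) (Fin dB) ℂ), IsPOVM A ∧ IsPOVM B ∧
      (z ∈ G → (lamGamma γ + Δ) ^ m *
        (1 + 3 * Real.sqrt (3 * Real.log (2 / ε)) * (2 : ℝ) ^ (-(n : ℝ) + m / 2)) ≤
          winProb γ A B ψ z) := by
    intro z
    by_cases hz : z ∈ G
    · obtain ⟨A, B, hA, hB, h⟩ := hz
      exact ⟨A, B, hA, hB, fun _ => h⟩
    · obtain ⟨A, hA⟩ := exists_isPOVM (m := m) (Fin dA)
      obtain ⟨B, hB⟩ := exists_isPOVM (m := m) (Fin dB)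
      exact ⟨A, B, hA, hB, fun h => absurd h hz⟩
  choose A B hA hB hwin using hex
  have hlam : 0 < lamGamma γ := by
    unfold lamGamma
    positivity
  have hpos : 0 < (lamGamma γ + Δ) ^ m := by positivity
  have hlow : ∀ z ∈ G, (lamGamma γ + Δ) ^ m ≤ winProb γ (A z) (B z) ψ z := by
    intro z hz
    refine le_trans (le_mul_of_one_le_right hpos.le ?_) (hwin z hz)
    have : 0 ≤ 3 * Real.sqrt (3 * Real.log (2 / ε)) * (2 : ℝ) ^ (-(n : ℝ) + m / 2) := by
      positivity
    linarith
  have hsum : (G.toFinset.card : ℝ) * (lamGamma γ + Δ) ^ m ≤ lamGamma γ ^ m * 2 ^ m := by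
    rw [← nsmul_eq_mul]
    refine (Finset.card_nsmul_le_sum G.toFinset (fun z => winProb γ (A z) (B z) ψ z) _
      fun z hz => hlow z (Set.mem_toFinset.mp hz)).trans ?_
    refine le_trans ?_ (sum_winProb_le hγ0 hγ1 A B hA hB ψ hψ)
    exact Finset.sum_le_sum_of_subset_of_nonneg (Finset.subset_univ _)
      fun z _ _ => winProb_nonneg γ (hA z) (hB z) ψ z
  rw [Set.ncard_eq_toFinset_card', div_pow, div_mul_eq_mul_div, le_div_iff₀ hpos]
  exact hsum
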